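/- For all m ≥ 4, the recursion r_0(m+1) > (3/4)·(m−2)²·r_0(m) holds. -/

import Mathlib

/-- The union of the hyperplanes of the braid arrangement `B_m` in `ℝ^m`:
`x_i = x_j` for `1 ≤ i < j ≤ m`. -/
def braidUnion (m : ℕ) : Set (Fin m → ℝ) :=
  ⋃ i : Fin m, ⋃ j : Fin m, ⋃ _ : i < j, {x | x i = x j}

/-- The union of the hyperplanes of the arrangement `N_m` in `ℝ^m`:
`x_i + x_j = x_k + x_l` for quadruples of distinct indices `(i,j,k,l)` with
`i < j`, `i < k < l`. -/
def midUnion (m : ℕ) : Set (Fin m → ℝ) :=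
  ⋃ i : Fin m, ⋃ j : Fin m, ⋃ k : Fin m, ⋃ l : Fin m,
    ⋃ _ : i < j, ⋃ _ : i < k, ⋃ _ : k < l, ⋃ _ : j ≠ k, ⋃ _ : j ≠ l,
      {x | x i + x j = x k + x l}

/-- The union of the hyperplanes of the mid-hyperplane arrangement
`M_m = B_m ∪ N_m`. -/
def midHyperplaneUnion (m : ℕ) : Set (Fin m → ℝ) :=
  braidUnion m ∪ midUnion m

/-- The chamber `C_0 = {x : x_1 < ⋯ < x_m}` of the braid arrangement. -/
def C0 (m : ℕ) : Set (Fin m → ℝ) := {x | StrictMono x}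

/-- The ranking pattern of the unidimensional unfolding model with objects
`x_1, …, x_m ∈ ℝ`: the set of rankings `(i_1 ⋯ i_m)` (permutations of
`{1,…,m}`, where `σ k = i_k`) such that
`|y - x_{i_1}| < ⋯ < |y - x_{i_m}|` for some `y ∈ ℝ`. -/
def RPUF {m : ℕ} (x : Fin m → ℝ) : Set (Equiv.Perm (Fin m)) :=
  {σ | ∃ y : ℝ, ∀ k l : Fin m, k < l → |y - x (σ k)| < |y - x (σ l)|}

/-- The chambers of an arrangement with union of hyperplanes `U`: the
connected components of the complement of `U`. -/
def chambersOf {m : ℕ} (U : Set (Fin m → ℝ)) : Set (Set (Fin m → ℝ)) :=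
  {C | ∃ y ∈ Uᶜ, C = connectedComponentIn Uᶜ y}

/-- `r_0(m)`: the number of ranking patterns of unidimensional unfolding
models with generic `m`-tuples such that `x_1 < ⋯ < x_m`. -/
noncomputable def r0 (m : ℕ) : ℕ :=
  {R : Set (Equiv.Perm (Fin m)) | ∃ x ∈ C0 m \ midUnion m, R = RPUF x}.ncard

/-- The strict comparisons between the pair sums `x i + x j` with `i < j`. -/
def pairOrder {m : ℕ} (x : Fin m → ℝ) : Set (Fin m × Fin m × Fin m × Fin m) :=
  {q | q.1 < q.2.1 ∧ q.2.2.1 < q.2.2.2 ∧ x q.1 + x q.2.1 < x q.2.2.1 + x q.2.2.2}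

theorem mem_pairOrder {m : ℕ} {x : Fin m → ℝ} {i j k l : Fin m} :
    (i, j, k, l) ∈ pairOrder x ↔ i < j ∧ k < l ∧ x i + x j < x k + x l := Iff.rfl

theorem abs_sub_lt_abs_sub_iff_of_lt {a b y : ℝ} (h : a < b) :
    |y - a| < |y - b| ↔ 2 * y < a + b := by
  rw [← sq_lt_sq]
  constructor <;> intro h' <;> nlinarith

theorem abs_sub_lt_abs_sub_iff_of_gt {a b y : ℝ} (h : a < b) :
    |y - b| < |y - a| ↔ a + b < 2 * y := by
  rw [← sq_lt_sq]
  constructor <;> intro h' <;> nlinarith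

theorem exists_ranking {m : ℕ} {x : Fin m → ℝ} (hx : StrictMono x) {y : ℝ}
    (hy : ∀ i j, 2 * y ≠ x i + x j) :
    ∃ σ : Equiv.Perm (Fin m), ∀ k l : Fin m, k < l → |y - x (σ k)| < |y - x (σ l)| := by
  have hinj : Function.Injective fun i => |y - x i| := by
    intro i j hij
    rcases abs_eq_abs.1 hij with h | h
    · exact hx.injective (by linarith)
    · exact absurd (by linarith) (hy i j)
  have hmono := Tuple.monotone_sort fun i => |y - x i|
  exact ⟨_, hmono.strictMono_of_injective (hinj.comp (Equiv.injective _))⟩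

theorem exists_between_notMem {a b : ℝ} (h : a < b) {s : Set ℝ} (hs : s.Finite) :
    ∃ y, a < y ∧ y < b ∧ y ∉ s := by
  obtain ⟨y, ⟨h1, h2⟩, h3⟩ := ((Set.Ioo_infinite h).sdiff hs).nonempty
  exact ⟨y, h1, h2, h3⟩

theorem mem_pairOrder_iff_RPUF {m : ℕ} {x : Fin m → ℝ} (hx : StrictMono x) {i j k l : Fin m}
    (hij : i < j) (hkl : k < l) :
    (i, j, k, l) ∈ pairOrder x ↔
      ∃ σ ∈ RPUF x, σ.symm j < σ.symm i ∧ σ.symm k < σ.symm l := by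
  constructor
  · rintro ⟨-, -, h⟩
    obtain ⟨z, h1, h2, h3⟩ := exists_between_notMem h
      (Set.finite_range fun p : Fin m × Fin m => x p.1 + x p.2)
    obtain ⟨σ, hσ⟩ := exists_ranking (y := z / 2) hx fun a b hab => h3 ⟨(a, b), by
      simp only; linarith⟩
    have key : StrictMono fun a => |z / 2 - x (σ a)| := fun a b hab => hσ a b hab
    refine ⟨σ, ⟨z / 2, hσ⟩, ?_, ?_⟩
    · rw [← key.lt_iff_lt]
      simp only [Equiv.apply_symm_apply]
      rw [abs_sub_lt_abs_sub_iff_of_gt (hx hij)]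
      linarith
    · rw [← key.lt_iff_lt]
      simp only [Equiv.apply_symm_apply]
      rw [abs_sub_lt_abs_sub_iff_of_lt (hx hkl)]
      linarith
  · rintro ⟨σ, ⟨y, hy⟩, h1, h2⟩
    have h3 := hy _ _ h1
    have h4 := hy _ _ h2
    simp only [Equiv.apply_symm_apply] at h3 h4
    rw [abs_sub_lt_abs_sub_iff_of_gt (hx hij)] at h3
    rw [abs_sub_lt_abs_sub_iff_of_lt (hx hkl)] at h4
    exact ⟨hij, hkl, h3.trans h4⟩

theorem RPUF_subset_of_pairOrder_eq {m : ℕ} {x x' : Fin m → ℝ} (hx : StrictMono x)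
    (hx' : StrictMono x') (h : pairOrder x = pairOrder x') : RPUF x ⊆ RPUF x' := by
  classical
  rintro σ ⟨y, hy⟩
  let lo : Finset (Fin m × Fin m) := {p | p.1 < p.2 ∧ x p.1 + x p.2 < 2 * y}
  let hi : Finset (Fin m × Fin m) := {p | p.1 < p.2 ∧ 2 * y < x p.1 + x p.2}
  obtain ⟨z, hz1, hz2⟩ := Order.exists_between_finsets
    (lo.image fun p => x' p.1 + x' p.2) (hi.image fun p => x' p.1 + x' p.2) (by
      simp only [Finset.mem_image, lo, hi, Finset.mem_filter, Finset.mem_univ, true_and]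
      rintro _ ⟨p, ⟨hp, hp'⟩, rfl⟩ _ ⟨q, ⟨hq, hq'⟩, rfl⟩
      have hpq : (p.1, p.2, q.1, q.2) ∈ pairOrder x := ⟨hp, hq, hp'.trans hq'⟩
      rw [h] at hpq
      exact hpq.2.2)
  simp only [Finset.mem_image, lo, hi, Finset.mem_filter, Finset.mem_univ, true_and] at hz1 hz2
  refine ⟨z / 2, fun k l hkl => ?_⟩
  have hkl' := hy k l hkl
  rcases lt_or_gt_of_ne (σ.injective.ne hkl.ne) with hlt | hlt
  · rw [abs_sub_lt_abs_sub_iff_of_lt (hx hlt)] at hkl'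
    rw [abs_sub_lt_abs_sub_iff_of_lt (hx' hlt)]
    have := hz2 _ ⟨(σ k, σ l), ⟨hlt, hkl'⟩, rfl⟩
    simp only at this
    linarith
  · rw [abs_sub_lt_abs_sub_iff_of_gt (hx hlt)] at hkl'
    rw [abs_sub_lt_abs_sub_iff_of_gt (hx' hlt)]
    have := hz1 _ ⟨(σ l, σ k), ⟨hlt, hkl'⟩, rfl⟩
    simp only at this
    linarith

theorem RPUF_eq_iff {m : ℕ} {x x' : Fin m → ℝ} (hx : StrictMono x) (hx' : StrictMono x') :
    RPUF x = RPUF x' ↔ pairOrder x = pairOrder x' := by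
  refine ⟨fun h => ?_, fun h => (RPUF_subset_of_pairOrder_eq hx hx' h).antisymm
    (RPUF_subset_of_pairOrder_eq hx' hx h.symm)⟩
  ext ⟨i, j, k, l⟩
  by_cases hij : i < j
  · by_cases hkl : k < l
    · rw [mem_pairOrder_iff_RPUF hx hij hkl, mem_pairOrder_iff_RPUF hx' hij hkl, h]
    · simp [mem_pairOrder, hkl]
  · simp [mem_pairOrder, hij]

open Classical in
/-- The orders of pair sums realized by generic increasing tuples. -/
noncomputable def pairOrders (m : ℕ) : Finset (Set (Fin m × Fin m × Fin m × Fin m)) :=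
  {R | ∃ x ∈ C0 m \ midUnion m, pairOrder x = R}

theorem mem_pairOrders {m : ℕ} {R : Set (Fin m × Fin m × Fin m × Fin m)} :
    R ∈ pairOrders m ↔ ∃ x ∈ C0 m \ midUnion m, pairOrder x = R := by
  simp [pairOrders]

theorem r0_eq_card_pairOrders (m : ℕ) : r0 m = (pairOrders m).card := by
  rw [r0, ← Set.ncard_coe_finset]
  have h : ∀ R ∈ {R | ∃ x ∈ C0 m \ midUnion m, R = RPUF x}, ∃ x ∈ C0 m \ midUnion m, R = RPUF x :=
    fun R hR => hR
  choose! f hf hf' using h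
  refine Set.ncard_congr (fun R _ => pairOrder (f R)) ?_ ?_ ?_
  · intro R hR
    exact mem_pairOrders.2 ⟨f R, hf R hR, rfl⟩
  · intro R R' hR hR' h
    rw [hf' R hR, hf' R' hR']
    exact (RPUF_eq_iff (hf R hR).1 (hf R' hR').1).2 h
  · intro Q hQ
    obtain ⟨x, hx, rfl⟩ := mem_pairOrders.1 hQ
    have hR : RPUF x ∈ {R | ∃ x ∈ C0 m \ midUnion m, R = RPUF x} := ⟨x, hx, rfl⟩
    exact ⟨RPUF x, hR, (RPUF_eq_iff (hf _ hR).1 hx.1).1 (hf' _ hR).symm⟩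

theorem notMem_midUnion {m : ℕ} {x : Fin m → ℝ} :
    x ∉ midUnion m ↔ ∀ i j k l : Fin m, i < j → i < k → k < l → j ≠ k → j ≠ l →
      x i + x j ≠ x k + x l := by
  simp only [midUnion, Set.mem_iUnion, Set.mem_ofPred_eq, not_exists, ne_eq]

theorem add_ne_add_of_generic {m : ℕ} {x : Fin m → ℝ} (hx : x ∈ C0 m \ midUnion m)
    {i j k l : Fin m} (hij : i < j) (hkl : k < l) (h : (i, j) ≠ (k, l)) :
    x i + x j ≠ x k + x l := by
  obtain ⟨hmono, hmid⟩ := hx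
  replace hmono : StrictMono x := hmono
  rw [notMem_midUnion] at hmid
  intro he
  rcases lt_trichotomy i k with hik | rfl | hik
  · by_cases hjk : j = k
    · subst hjk
      linarith [hmono hij, hmono hkl]
    · by_cases hjl : j = l
      · subst hjl
        linarith [hmono hik]
      · exact hmid i j k l hij hik hkl hjk hjl he
  · have : j = l := hmono.injective (by linarith)
    exact h (by rw [this])
  · by_cases hli : l = i
    · subst hli
      linarith [hmono hij, hmono hkl]
    · by_cases hlj : l = j
      · subst hlj
        linarith [hmono hik]
      · exact hmid k l i j hkl hik hij hli hlj he.symm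

theorem pairOrders_nonempty (m : ℕ) : (pairOrders m).Nonempty := by
  refine ⟨_, mem_pairOrders.2 ⟨fun i => (2 : ℝ) ^ (i : ℕ), ⟨?_, ?_⟩, rfl⟩⟩
  · intro i j hij
    exact pow_lt_pow_right₀ (by norm_num) hij
  · rw [notMem_midUnion]
    intro i j k l hij hik hkl _ _ h
    have h' : 2 ^ (i : ℕ) + 2 ^ (j : ℕ) = 2 ^ (k : ℕ) + 2 ^ (l : ℕ) := by exact_mod_cast h
    have hd : ∀ a : Fin m, i < a → 2 ^ ((i : ℕ) + 1) ∣ 2 ^ (a : ℕ) := fun a ha =>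
      pow_dvd_pow 2 ha
    have h2 : 2 ^ ((i : ℕ) + 1) ∣ 2 ^ (i : ℕ) :=
      (Nat.dvd_add_left (hd j hij)).1 (h' ▸ dvd_add (hd k hik) (hd l (hik.trans hkl)))
    have := (Nat.pow_dvd_pow_iff_le_right (by norm_num)).1 h2
    omega

/-- The position at which an appended point `t` satisfies `x i + t = x k + x l`,
for `q = (i, k, l)`. -/
def threshold {m : ℕ} (x : Fin m → ℝ) (q : Fin m × Fin m × Fin m) : ℝ :=
  x q.2.1 + x q.2.2 - x q.1

theorem ae_threshold_ne {m : ℕ} {p q : Fin m × Fin m × Fin m} (hp : p.1 < p.2.1)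
    (hp' : p.2.1 < p.2.2) (hq : q.1 < q.2.1) (hq' : q.2.1 < q.2.2) (hpq : p ≠ q) :
    ∀ᵐ x : Fin m → ℝ, threshold x p ≠ threshold x q := by
  obtain ⟨i, k, l⟩ := p
  obtain ⟨i', k', l'⟩ := q
  simp only at hp hp' hq hq'
  let f : Fin m → (Fin m → ℝ) →ₗ[ℝ] ℝ := fun a => LinearMap.proj a
  let φ := f k + f l - f i - (f k' + f l' - f i')
  have hφ : LinearMap.ker φ ≠ ⊤ := by
    intro htop
    have hz : ∀ x : Fin m → ℝ, x k + x l - x i - (x k' + x l' - x i') = 0 := fun x => by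
      have : x ∈ LinearMap.ker φ := htop ▸ Submodule.mem_top
      simpa [φ, f] using this
    apply hpq
    have hi : i = i' := by
      by_contra hne
      have := hz (Pi.single i 1)
      simp only [Pi.single_apply, hp.ne', (hp.trans hp').ne', Ne.symm hne, if_true, if_false] at this
      split_ifs at this <;> norm_num at this
    subst hi
    have hk : k = k' ∨ k = l' := by
      by_contra! hne
      have := hz (Pi.single k 1)
      simp [hp'.ne', hp.ne, Ne.symm hne.1, Ne.symm hne.2] at this
    have hl : l = k' ∨ l = l' := by
      by_contra! hne
      have := hz (Pi.single l 1)
      simp [hp'.ne, (hp.trans hp').ne, Ne.symm hne.1, Ne.symm hne.2] at this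
    have : k = k' ∧ l = l' := by omega
    rw [this.1, this.2]
  have h0 := MeasureTheory.Measure.addHaar_submodule MeasureTheory.volume _ hφ
  rw [MeasureTheory.ae_iff]
  refine MeasureTheory.measure_mono_null ?_ h0
  intro x hx
  simp only [threshold, ne_eq, not_not, Set.mem_ofPred_eq] at hx
  simp [φ, f, hx]

theorem exists_pairOrder_eq_threshold_injOn {m : ℕ} {x : Fin m → ℝ}
    (hx : x ∈ C0 m \ midUnion m) :
    ∃ x' ∈ C0 m \ midUnion m, pairOrder x' = pairOrder x ∧
      Set.InjOn (threshold x') {q | q.1 < q.2.1 ∧ q.2.1 < q.2.2} := by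
  have hmono : StrictMono x := hx.1
  have hopen : ∀ᶠ x' in nhds x, (∀ i j, i < j → x' i < x' j) ∧
      ∀ i j k l, x i + x j < x k + x l → x' i + x' j < x' k + x' l := by
    simp only [Filter.eventually_and, Filter.eventually_all]
    refine ⟨fun i j hij => ?_, fun i j k l h => ?_⟩
    · exact (isOpen_lt (continuous_apply i) (continuous_apply j)).mem_nhds (hmono hij)
    · exact (isOpen_lt ((continuous_apply i).add (continuous_apply j))
        ((continuous_apply k).add (continuous_apply l))).mem_nhds h
  have hae : ∀ᵐ x' : Fin m → ℝ, ∀ p q : Fin m × Fin m × Fin m, p.1 < p.2.1 → p.2.1 < p.2.2 →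
      q.1 < q.2.1 → q.2.1 < q.2.2 → p ≠ q → threshold x' p ≠ threshold x' q := by
    simp only [MeasureTheory.ae_all_iff]
    exact fun p q h1 h2 h3 h4 h5 => ae_threshold_ne h1 h2 h3 h4 h5
  obtain ⟨x', hx', ⟨hmono', hlt⟩⟩ :=
    ((mem_closure_iff_frequently.1 (MeasureTheory.Measure.dense_of_ae hae x)).and_eventually
      hopen).exists
  have hne : ∀ i j k l : Fin m, i < j → k < l → (i, j) ≠ (k, l) → x' i + x' j ≠ x' k + x' l := by
    intro i j k l hij hkl h
    rcases lt_or_gt_of_ne (add_ne_add_of_generic hx hij hkl h) with h' | h'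
    · exact (hlt _ _ _ _ h').ne
    · exact (hlt _ _ _ _ h').ne'
  refine ⟨x', ⟨fun i j => hmono' i j, ?_⟩, ?_, ?_⟩
  · rw [notMem_midUnion]
    intro i j k l hij hik hkl _ _
    exact hne i j k l hij hkl fun h => hik.ne (congrArg Prod.fst h)
  · ext ⟨i, j, k, l⟩
    simp only [mem_pairOrder]
    refine and_congr_right fun hij => and_congr_right fun hkl => ⟨fun h => ?_, hlt _ _ _ _⟩
    by_contra! h'
    rcases h'.lt_or_eq with h' | h'
    · exact (hlt _ _ _ _ h').not_gt h
    · have heq : (i, j) = (k, l) := by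
        by_contra hc
        exact add_ne_add_of_generic hx hij hkl hc h'.symm
      simp only [Prod.mk.injEq] at heq
      rw [heq.1, heq.2] at h
      exact lt_irrefl _ h
  · intro p hp q hq h
    by_contra hpq
    exact hx' p q hp.1 hp.2 hq.1 hq.2 hpq h

theorem snoc_generic {n : ℕ} {x : Fin (n + 1) → ℝ} (hx : x ∈ C0 (n + 1) \ midUnion (n + 1))
    {t : ℝ} (ht : x (Fin.last n) < t) (ht' : ∀ q, t ≠ threshold x q) :
    (Fin.snoc x t : Fin (n + 2) → ℝ) ∈ C0 (n + 2) \ midUnion (n + 2) := by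
  have hmono : StrictMono x := hx.1
  have hlt : ∀ i, x i < t := fun i => (hmono.monotone (Fin.le_last i)).trans_lt ht
  refine ⟨?_, ?_⟩
  · intro i j
    refine Fin.lastCases ?_ (fun i => ?_) i
    · intro h
      exact absurd h (Fin.le_last j).not_gt
    · refine Fin.lastCases ?_ (fun j => ?_) j
      · intro _
        simpa using hlt i
      · simpa using fun h => hmono h
  · have hmid := notMem_midUnion.1 hx.2
    rw [notMem_midUnion]
    intro i j k l hij hik hkl hjk hjl
    obtain ⟨i, rfl⟩ := Fin.exists_castSucc_eq.2 (hij.trans_le (Fin.le_last _)).ne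
    obtain ⟨k, rfl⟩ := Fin.exists_castSucc_eq.2 (hkl.trans_le (Fin.le_last _)).ne
    by_cases hj : j = Fin.last _
    · subst hj
      obtain ⟨l, rfl⟩ := Fin.exists_castSucc_eq.2 hjl.symm
      simp only [Fin.snoc_castSucc, Fin.snoc_last]
      intro h
      exact ht' (i, k, l) (by simp only [threshold]; linarith)
    · obtain ⟨j, rfl⟩ := Fin.exists_castSucc_eq.2 hj
      by_cases hl : l = Fin.last _
      · subst hl
        simp only [Fin.snoc_castSucc, Fin.snoc_last]
        intro h
        exact ht' (k, i, j) (by simp only [threshold]; linarith)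
      · obtain ⟨l, rfl⟩ := Fin.exists_castSucc_eq.2 hl
        simp only [Fin.snoc_castSucc]
        exact hmid i j k l (by simpa using hij) (by simpa using hik) (by simpa using hkl)
          (by simpa using hjk) (by simpa using hjl)

/-- The order of pair sums obtained by forgetting the last point. -/
def restrictLast {m : ℕ} (R : Set (Fin (m + 1) × Fin (m + 1) × Fin (m + 1) × Fin (m + 1))) :
    Set (Fin m × Fin m × Fin m × Fin m) :=
  {q | (q.1.castSucc, q.2.1.castSucc, q.2.2.1.castSucc, q.2.2.2.castSucc) ∈ R}

theorem restrictLast_pairOrder {m : ℕ} (x : Fin (m + 1) → ℝ) :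
    restrictLast (pairOrder x) = pairOrder fun i => x i.castSucc := by
  ext ⟨i, j, k, l⟩
  simp [restrictLast, mem_pairOrder]

theorem restrictLast_mem {m : ℕ} {R : Set (Fin (m + 1) × Fin (m + 1) × Fin (m + 1) × Fin (m + 1))}
    (hR : R ∈ pairOrders (m + 1)) : restrictLast R ∈ pairOrders m := by
  obtain ⟨x, ⟨hmono, hmid⟩, rfl⟩ := mem_pairOrders.1 hR
  refine mem_pairOrders.2 ⟨fun i => x i.castSucc, ⟨fun i j h => hmono (by simpa using h), ?_⟩,
    (restrictLast_pairOrder x).symm⟩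
  rw [notMem_midUnion] at hmid ⊢
  intro i j k l h1 h2 h3 h4 h5
  exact hmid _ _ _ _ (by simpa using h1) (by simpa using h2) (by simpa using h3)
    (by simpa using h4) (by simpa using h5)

/-- The pairs `i < j` in `Fin n`. -/
def ltPairs (n : ℕ) : Finset (Fin n × Fin n) := {p | p.1 < p.2}

theorem two_mul_card_ltPairs (n : ℕ) : 2 * (ltPairs n).card + n = n * n := by
  have h1 : (ltPairs n).card = ({p | p.2 < p.1} : Finset (Fin n × Fin n)).card := by
    refine Finset.card_bij (fun p _ => p.swap) ?_ ?_ ?_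
    · simp [ltPairs]
    · simp
    · intro p hp
      exact ⟨p.swap, by simpa [ltPairs] using hp, by simp⟩
  have h2 : (Finset.univ.diag : Finset (Fin n × Fin n)).card = n := by simp
  have h3 : (Finset.univ : Finset (Fin n × Fin n)) =
      (ltPairs n ∪ ({p | p.2 < p.1} : Finset (Fin n × Fin n))) ∪ Finset.univ.diag := by
    ext ⟨i, j⟩
    simp only [ltPairs, Finset.mem_union, Finset.mem_filter, Finset.mem_univ, true_and,
      Finset.mem_diag, true_iff]
    omega
  have h4 := congrArg Finset.card h3
  rw [Finset.card_union_of_disjoint, Finset.card_union_of_disjoint, h2, ← h1] at h4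
  · simp only [Finset.card_univ, Fintype.card_prod, Fintype.card_fin] at h4
    omega
  · simp only [Finset.disjoint_left, ltPairs, Finset.mem_filter, Finset.mem_univ, true_and]
    intro p h; omega
  · simp only [Finset.disjoint_left, ltPairs, Finset.mem_filter, Finset.mem_univ, true_and,
      Finset.mem_union, Finset.mem_diag]
    intro p h; omega

/-- The order relation compares the sum of the extreme points with the sum of an interior pair;
this is the set of interior pairs with larger sum. -/
def wideInner {n : ℕ} (R : Set (Fin (n + 2) × Fin (n + 2) × Fin (n + 2) × Fin (n + 2))) :
    Set (Fin n × Fin n) :=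
  {p | (0, Fin.last (n + 1), p.1.succ.castSucc, p.2.succ.castSucc) ∈ R}

open Classical in
theorem card_threshold_gt {n : ℕ} {x : Fin (n + 2) → ℝ} (hx : StrictMono x) :
    (ltPairs (n + 1)).card + ((ltPairs n).filter (· ∈ wideInner (pairOrder x))).card ≤
      (Finset.univ.filter fun q : Fin (n + 2) × Fin (n + 2) × Fin (n + 2) =>
        (q.1 < q.2.1 ∧ q.2.1 < q.2.2) ∧ x (Fin.last (n + 1)) < threshold x q).card := by
  rw [← Finset.card_disjSum]
  refine Finset.card_le_card_of_injOn
    (Sum.elim (fun p => (p.1.castSucc, p.2.castSucc, Fin.last (n + 1)))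
      (fun p => (0, p.1.succ.castSucc, p.2.succ.castSucc))) ?_ ?_
  · rintro (⟨i, k⟩ | ⟨k, l⟩) h
    · have h' : i < k := by simpa [ltPairs] using h
      have := hx (Fin.castSucc_lt_castSucc_iff.2 h')
      rw [Finset.mem_coe, Finset.mem_filter]
      refine ⟨Finset.mem_univ _, ⟨by simpa using h', Fin.castSucc_lt_last _⟩, ?_⟩
      simp only [Sum.elim_inl, threshold]
      linarith
    · have h' : k < l ∧ (k, l) ∈ wideInner (pairOrder x) := by simpa [ltPairs] using h
      have h2 := h'.2.2.2
      simp only at h2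
      have h3 : (0 : Fin (n + 2)) < k.succ.castSucc := by simp [Fin.lt_def]
      rw [Finset.mem_coe, Finset.mem_filter]
      simp only [Sum.elim_inr, Finset.mem_univ, true_and, threshold]
      refine ⟨⟨h3, by simpa using h'.1⟩, by linarith⟩
  · rintro (⟨i, k⟩ | ⟨k, l⟩) _ (⟨i', k'⟩ | ⟨k', l'⟩) _ h
    · simpa using h
    · exact absurd (congrArg (fun q => q.2.2) h) (Fin.castSucc_lt_last _).ne'
    · exact absurd (congrArg (fun q => q.2.2) h) (Fin.castSucc_lt_last _).ne
    · simpa using h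

theorem exists_gt_forall_notMem_Ioc (a : ℝ) {s : Set ℝ} (hs : s.Finite) :
    ∃ t, a < t ∧ ∀ b ∈ s, b ≤ a ∨ t < b := by
  obtain ⟨t, h1, h2⟩ := Order.exists_between_finsets {a} (hs.toFinset.filter (a < ·)) (by simp)
  refine ⟨t, h1 a (by simp), fun b hb => ?_⟩
  rcases le_or_gt b a with h | h
  · exact Or.inl h
  · exact Or.inr (h2 b (by simp [hb, h]))

open Classical in
theorem card_fiber_restrictLast {n : ℕ}
    {R : Set (Fin (n + 2) × Fin (n + 2) × Fin (n + 2) × Fin (n + 2))}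
    (hR : R ∈ pairOrders (n + 2)) :
    (ltPairs (n + 1)).card + ((ltPairs n).filter (· ∈ wideInner R)).card + 1 ≤
      ((pairOrders (n + 3)).filter (restrictLast · = R)).card := by
  obtain ⟨x₀, hx₀, rfl⟩ := mem_pairOrders.1 hR
  obtain ⟨x, hx, hxx, hinj⟩ := exists_pairOrder_eq_threshold_injOn hx₀
  rw [← hxx]
  set T := Finset.univ.filter fun q : Fin (n + 2) × Fin (n + 2) × Fin (n + 2) =>
        (q.1 < q.2.1 ∧ q.2.1 < q.2.2) ∧ x (Fin.last (n + 1)) < threshold x q with hT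
  have hcard : (insert (x (Fin.last (n + 1))) (T.image (threshold x))).card = T.card + 1 := by
    rw [Finset.card_insert_of_notMem, Finset.card_image_of_injOn]
    · exact hinj.mono fun q hq => (Finset.mem_filter.1 hq).2.1
    · simp only [Finset.mem_image, not_exists, not_and]
      intro q hq h
      exact ((Finset.mem_filter.1 hq).2.2).ne' h
  refine (Nat.add_le_add_right (card_threshold_gt hx.1) 1).trans (hcard ▸ ?_)
  choose t ht ht' using fun a => exists_gt_forall_notMem_Ioc a (Set.finite_range (threshold x))
  have hge : ∀ a ∈ insert (x (Fin.last (n + 1))) (T.image (threshold x)),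
      x (Fin.last (n + 1)) ≤ a := by
    intro a ha
    rcases Finset.mem_insert.1 ha with rfl | ha
    · exact le_rfl
    · obtain ⟨q, hq, rfl⟩ := Finset.mem_image.1 ha
      exact (Finset.mem_filter.1 hq).2.2.le
  have hsep : ∀ a ∈ insert (x (Fin.last (n + 1))) (T.image (threshold x)),
      ∀ b ∈ insert (x (Fin.last (n + 1))) (T.image (threshold x)), a < b →
      pairOrder (Fin.snoc x (t a) : Fin (n + 3) → ℝ) ≠ pairOrder (Fin.snoc x (t b)) := by
    intro a ha b hb hab h
    rcases Finset.mem_insert.1 hb with rfl | hb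
    · exact (hge a ha).not_gt hab
    · obtain ⟨q, hq, rfl⟩ := Finset.mem_image.1 hb
      have h1 : t a < threshold x q := (ht' a _ ⟨q, rfl⟩).resolve_left hab.not_ge
      have h2 := ht (threshold x q)
      have hq' := (Finset.mem_filter.1 hq).2.1
      have hmem : (q.1.castSucc, Fin.last (n + 2), q.2.1.castSucc, q.2.2.castSucc) ∈
          pairOrder (Fin.snoc x (t a) : Fin (n + 3) → ℝ) := by
        refine ⟨Fin.castSucc_lt_last _, by simpa using hq'.2, ?_⟩
        simp only [Fin.snoc_castSucc, Fin.snoc_last]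
        simp only [threshold] at h1
        linarith
      rw [h] at hmem
      have h3 := hmem.2.2
      simp only [Fin.snoc_castSucc, Fin.snoc_last] at h3
      simp only [threshold] at h2 h3
      linarith
  refine Finset.card_le_card_of_injOn
    (fun a => pairOrder (Fin.snoc x (t a) : Fin (n + 3) → ℝ)) ?_ ?_
  · intro a ha
    simp only [Finset.coe_filter, Set.mem_ofPred_eq]
    refine ⟨mem_pairOrders.2 ⟨_, snoc_generic hx ((hge a ha).trans_lt (ht a)) ?_, rfl⟩, ?_⟩
    · intro q hq
      rcases ht' a _ ⟨q, rfl⟩ with h | h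
      · linarith [ht a]
      · linarith
    · rw [restrictLast_pairOrder]
      simp only [Fin.snoc_castSucc]
  · intro a ha b hb h
    by_contra hab
    rcases lt_or_gt_of_ne hab with hab | hab
    · exact hsep a ha b hb hab h
    · exact hsep b hb a ha hab h.symm

/-- The order of pair sums of the reflected tuple. -/
def mirror {m : ℕ} (R : Set (Fin m × Fin m × Fin m × Fin m)) :
    Set (Fin m × Fin m × Fin m × Fin m) :=
  {q | (q.2.2.2.rev, q.2.2.1.rev, q.2.1.rev, q.1.rev) ∈ R}

theorem mirror_mirror {m : ℕ} (R : Set (Fin m × Fin m × Fin m × Fin m)) :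
    mirror (mirror R) = R := by
  ext ⟨i, j, k, l⟩
  simp [mirror]

theorem mirror_mem {m : ℕ} {R : Set (Fin m × Fin m × Fin m × Fin m)} (hR : R ∈ pairOrders m) :
    mirror R ∈ pairOrders m := by
  obtain ⟨x, hx, rfl⟩ := mem_pairOrders.1 hR
  refine mem_pairOrders.2 ⟨fun i => -x i.rev, ⟨fun i j h => ?_, ?_⟩, ?_⟩
  · exact neg_lt_neg (hx.1 (Fin.rev_lt_rev.2 h))
  · rw [notMem_midUnion]
    intro i j k l hij hik hkl hjk hjl h
    refine add_ne_add_of_generic hx (Fin.rev_lt_rev.2 hij) (Fin.rev_lt_rev.2 hkl) ?_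
      (by linarith)
    simp only [ne_eq, Prod.mk.injEq, Fin.rev_inj, not_and]
    exact fun h => absurd h hjl
  · ext ⟨i, j, k, l⟩
    simp only [mirror, mem_pairOrder, Set.mem_ofPred_eq, Fin.rev_lt_rev]
    constructor
    · rintro ⟨h1, h2, h3⟩
      exact ⟨h2, h1, by linarith⟩
    · rintro ⟨h1, h2, h3⟩
      exact ⟨h2, h1, by linarith⟩

open Classical in
theorem card_wideInner_add_mirror {n : ℕ}
    {R : Set (Fin (n + 2) × Fin (n + 2) × Fin (n + 2) × Fin (n + 2))}
    (hR : R ∈ pairOrders (n + 2)) :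
    ((ltPairs n).filter (· ∈ wideInner R)).card +
      ((ltPairs n).filter (· ∈ wideInner (mirror R))).card = (ltPairs n).card := by
  rw [← Finset.card_filter_add_card_filter_not (s := ltPairs n) (· ∈ wideInner R)]
  congr 1
  obtain ⟨x, hx, rfl⟩ := mem_pairOrders.1 hR
  have key : ∀ k l : Fin n, k < l → ((k, l) ∈ wideInner (mirror (pairOrder x)) ↔
      (l.rev, k.rev) ∉ wideInner (pairOrder x)) := by
    intro k l hkl
    have h0 : (0 : Fin (n + 2)) < Fin.last (n + 1) := Fin.last_pos
    have hlt : l.rev.succ.castSucc < k.rev.succ.castSucc := by simpa using hkl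
    have hne := add_ne_add_of_generic hx h0 hlt (by simp [Fin.ext_iff])
    have e : ∀ a : Fin n, (a.succ.castSucc).rev = a.rev.succ.castSucc := fun a => by
      rw [Fin.rev_castSucc, Fin.rev_succ, Fin.succ_castSucc]
    simp only [wideInner, mirror, Set.mem_ofPred_eq, e, Fin.rev_last, Fin.rev_zero, mem_pairOrder,
      h0, hlt, true_and, not_lt]
    exact ⟨le_of_lt, fun h => lt_of_le_of_ne h hne.symm⟩
  refine Finset.card_bij (fun p _ => (p.2.rev, p.1.rev)) ?_ ?_ ?_
  · rintro ⟨k, l⟩ h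
    simp only [Finset.mem_filter, ltPairs, Finset.mem_univ, true_and] at h ⊢
    exact ⟨Fin.rev_lt_rev.2 h.1, (key k l h.1).1 h.2⟩
  · rintro ⟨k, l⟩ _ ⟨k', l'⟩ _ h
    simp only [Prod.mk.injEq, Fin.rev_inj] at h
    rw [h.1, h.2]
  · rintro ⟨k, l⟩ h
    simp only [Finset.mem_filter, ltPairs, Finset.mem_univ, true_and] at h
    refine ⟨(l.rev, k.rev), ?_, by simp⟩
    simp only [Finset.mem_filter, ltPairs, Finset.mem_univ, true_and]
    refine ⟨Fin.rev_lt_rev.2 h.1, (key _ _ (Fin.rev_lt_rev.2 h.1)).2 ?_⟩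
    simpa using h.2

open Classical in
theorem two_mul_sum_card_wideInner (n : ℕ) :
    2 * ∑ R ∈ pairOrders (n + 2), ((ltPairs n).filter (· ∈ wideInner R)).card =
      (pairOrders (n + 2)).card * (ltPairs n).card := by
  have h : ∑ R ∈ pairOrders (n + 2), ((ltPairs n).filter (· ∈ wideInner R)).card =
      ∑ R ∈ pairOrders (n + 2), ((ltPairs n).filter (· ∈ wideInner (mirror R))).card :=
    Finset.sum_bij' (fun R _ => mirror R) (fun R _ => mirror R) (fun _ => mirror_mem)
      (fun _ => mirror_mem) (fun R _ => mirror_mirror R) (fun R _ => mirror_mirror R)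
      (fun R _ => by rw [mirror_mirror])
  rw [two_mul]
  nth_rewrite 2 [h]
  rw [← Finset.sum_add_distrib, Finset.sum_congr rfl fun R hR => card_wideInner_add_mirror hR,
    Finset.sum_const, smul_eq_mul]

theorem two_mul_r0_succ_ge (n : ℕ) :
    r0 (n + 2) * (2 * (ltPairs (n + 1)).card + (ltPairs n).card + 2) ≤ 2 * r0 (n + 3) := by
  classical
  rw [r0_eq_card_pairOrders, r0_eq_card_pairOrders (n + 3),
    Finset.card_eq_sum_card_fiberwise (s := pairOrders (n + 3)) (t := pairOrders (n + 2))
      fun R hR => restrictLast_mem hR]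
  have h := Finset.sum_le_sum fun R (hR : R ∈ pairOrders (n + 2)) => card_fiber_restrictLast hR
  rw [Finset.sum_add_distrib, Finset.sum_add_distrib, Finset.sum_const, Finset.sum_const,
    smul_eq_mul, smul_eq_mul] at h
  have h2 := two_mul_sum_card_wideInner n
  nlinarith

/-- Recursion: for all `m ≥ 4`, `r_0(m+1) > (3/4)·(m-2)²·r_0(m)`. -/
theorem r0_recursion (m : ℕ) (hm : 4 ≤ m) :
    (3 / 4 : ℝ) * ((m : ℝ) - 2) ^ 2 * (r0 m : ℝ) < (r0 (m + 1) : ℝ) := by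
  obtain ⟨n, rfl⟩ := Nat.exists_eq_add_of_le' (show 2 ≤ m by omega)
  have h1 : ((r0 (n + 2) * (2 * (ltPairs (n + 1)).card + (ltPairs n).card + 2) : ℕ) : ℝ) ≤
      ((2 * r0 (n + 3) : ℕ) : ℝ) := Nat.cast_le.2 (two_mul_r0_succ_ge n)
  have h2 : ((2 * (ltPairs n).card + n : ℕ) : ℝ) = ((n * n : ℕ) : ℝ) :=
    congrArg _ (two_mul_card_ltPairs n)
  have h3 : ((2 * (ltPairs (n + 1)).card + (n + 1) : ℕ) : ℝ) = (((n + 1) * (n + 1) : ℕ) : ℝ) :=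
    congrArg _ (two_mul_card_ltPairs (n + 1))
  have h4 : (0 : ℝ) < r0 (n + 2) := by
    rw [r0_eq_card_pairOrders]
    exact Nat.cast_pos.2 (pairOrders_nonempty _).card_pos
  push_cast at h1 h2 h3 ⊢
  have h5 : 2 * ((ltPairs (n + 1)).card : ℝ) + (ltPairs n).card + 2 =
      (3 * n ^ 2 + n) / 2 + 2 := by linarith
  rw [h5] at h1
  have h6 : (0 : ℝ) ≤ n * r0 (n + 2) := by positivity
  change _ < (r0 (n + 3) : ℝ)
  nlinarith
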